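/- Let f : ℕ → ℂ be a non-identically-zero function that is periodic with period q ≥ 1, and let 0 < α < 1 be a transcendental real number. Then the function F(s, f, α) = ∑_{n=0}^∞ f(n)/(n+α)^s has infinitely many zeros s with Re(s) > 1. -/

import Mathlib

open Filter Topology MeasureTheory

theorem mFourier_coe_mul {ι : Type*} [Fintype ι] (l : ι → ℝ) (k : ι → ℤ) (t : ℝ) :
    UnitAddTorus.mFourier k (fun i => ((t * l i : ℝ) : UnitAddCircle)) =
      Complex.exp (2 * Real.pi * Complex.I * ((∑ i, k i * l i : ℝ) : ℂ) * t) := by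
  simp only [UnitAddTorus.mFourier, ContinuousMap.coe_mk, fourier_coe_apply, ← Complex.exp_sum]
  congr 1
  push_cast
  rw [Finset.mul_sum, Finset.sum_mul]
  refine Finset.sum_congr rfl fun i _ => ?_
  simp only [div_one]
  ring

theorem integral_mFourier_haar {ι : Type*} [Fintype ι] {k : ι → ℤ} (hk : k ≠ 0) :
    ∫ x, UnitAddTorus.mFourier k x
      ∂(Measure.pi fun _ : ι => (AddCircle.haarAddCircle : Measure UnitAddCircle)) = 0 := by
  obtain ⟨i, hi⟩ := Function.ne_iff.mp hk
  simp only [UnitAddTorus.mFourier, ContinuousMap.coe_mk]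
  rw [integral_fintype_prod_eq_prod (f := fun i (x : UnitAddCircle) => fourier (k i) x)]
  refine Finset.prod_eq_zero (Finset.mem_univ i) ?_
  exact integral_eq_zero_of_add_right_eq_neg (fourier_add_half_inv_index hi one_pos)

theorem tendsto_mean_exp {c : ℂ} (hc : c ≠ 0) (hre : c.re = 0) (T₀ : ℝ) :
    Tendsto (fun T : ℝ => (T : ℂ)⁻¹ * ∫ t in T₀..(T₀ + T), Complex.exp (c * t)) atTop (𝓝 0) := by
  have h1 : Tendsto (fun T : ℝ => T⁻¹ * (2 / ‖c‖)) atTop (𝓝 0) := by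
    simpa using tendsto_inv_atTop_zero.mul_const (2 / ‖c‖)
  refine squeeze_zero_norm' ?_ h1
  filter_upwards [eventually_gt_atTop 0] with T hT
  have hn : ∀ t : ℝ, ‖Complex.exp (c * t)‖ = 1 := fun t => by
    simp [Complex.norm_exp, hre]
  rw [integral_exp_mul_complex hc, norm_mul, norm_div, norm_inv, Complex.norm_real,
    Real.norm_of_nonneg hT.le]
  gcongr
  refine (norm_sub_le _ _).trans ?_
  rw [hn, hn]
  norm_num

/-- **Kronecker's theorem**: a linear flow on the torus with rationally independent frequencies
has dense forward orbits. -/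
theorem dense_forward_orbit_of_linearIndependent {ι : Type*} [Fintype ι] (l : ι → ℝ)
    (hl : ∀ k : ι → ℤ, ∑ i, k i * l i = 0 → k = 0) (T₀ : ℝ) :
    Dense ((fun t : ℝ => (fun i => ((t * l i : ℝ) : UnitAddCircle) : UnitAddTorus ι)) ''
      Set.Ici T₀) := by
  set φ : ℝ → UnitAddTorus ι := fun t i => ((t * l i : ℝ) : UnitAddCircle) with hφ
  have hφc : Continuous φ := by
    refine continuous_pi fun i => ?_
    exact (AddCircle.continuous_mk' 1).comp (continuous_id.mul continuous_const)
  let μ : Measure (UnitAddTorus ι) :=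
    Measure.pi fun _ : ι => (AddCircle.haarAddCircle : Measure UnitAddCircle)
  have hint : ∀ g : C(UnitAddTorus ι, ℂ), Integrable g μ := fun g =>
    g.continuous.integrable_of_hasCompactSupport (HasCompactSupport.of_compactSpace _)
  have hmean : ∀ p ∈ Submodule.span ℂ (Set.range (UnitAddTorus.mFourier (d := ι))),
      Tendsto (fun T : ℝ => (T : ℂ)⁻¹ * ∫ t in T₀..(T₀ + T), p (φ t)) atTop
        (𝓝 (∫ x, p x ∂μ)) := by
    intro p hp
    induction hp using Submodule.span_induction with
    | mem p hp =>
      obtain ⟨k, rfl⟩ := hp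
      simp only [hφ, mFourier_coe_mul]
      by_cases hk : k = 0
      · subst hk
        have hI : ∫ x, UnitAddTorus.mFourier (0 : ι → ℤ) x ∂μ = 1 := by
          simp [UnitAddTorus.mFourier_zero, μ]
        rw [hI]
        refine Tendsto.congr' ?_ tendsto_const_nhds
        filter_upwards [eventually_gt_atTop 0] with T hT
        have : (T : ℂ) ≠ 0 := by exact_mod_cast hT.ne'
        simp [this]
      · rw [integral_mFourier_haar hk]
        refine tendsto_mean_exp ?_ ?_ T₀
        · have : ∑ i, k i * l i ≠ 0 := fun h => hk (hl k h)
          simp only [ne_eq, mul_eq_zero, Complex.ofReal_eq_zero, this, Real.pi_ne_zero,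
            Complex.I_ne_zero, OfNat.ofNat_ne_zero, or_self, not_false_eq_true]
        · simp
    | zero => simp
    | add p r _ _ hp hr =>
      simp only [ContinuousMap.add_apply]
      rw [integral_add (hint p) (hint r)]
      refine (hp.add hr).congr fun T => ?_
      rw [intervalIntegral.integral_add, mul_add]
      · exact (p.continuous.comp hφc).intervalIntegrable _ _
      · exact (r.continuous.comp hφc).intervalIntegrable _ _
    | smul a p _ hp =>
      simp only [ContinuousMap.smul_apply, smul_eq_mul]
      rw [integral_const_mul]
      refine (hp.const_mul a).congr fun T => ?_
      rw [intervalIntegral.integral_const_mul]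
      ring
  intro y
  by_contra hy
  obtain ⟨g, hg0, hg1, hg⟩ := exists_continuous_zero_one_of_isClosed
    (isClosed_closure (s := φ '' Set.Ici T₀)) (isClosed_singleton (x := y))
    (Set.disjoint_singleton_right.mpr hy)
  have hpos : 0 < ∫ x, g x ∂μ := by
    refine g.continuous.integral_pos_of_hasCompactSupport_nonneg_nonzero
      (HasCompactSupport.of_compactSpace _) (fun x => (hg x).1) (x := y) ?_
    rw [hg1 rfl]
    exact one_ne_zero
  set δ : ℝ := (∫ x, g x ∂μ) / 3 with hδ
  let G : C(UnitAddTorus ι, ℂ) := ⟨fun x => (g x : ℂ), by fun_prop⟩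
  have hG : G ∈ closure ((Submodule.span ℂ (Set.range (UnitAddTorus.mFourier (d := ι))) :
      Set C(UnitAddTorus ι, ℂ))) := by
    rw [← Submodule.topologicalClosure_coe, UnitAddTorus.span_mFourier_closure_eq_top]
    trivial
  obtain ⟨p, hp, hpG⟩ := Metric.mem_closure_iff.mp hG δ (by positivity)
  have hpG' : ∀ x, ‖G x - p x‖ ≤ δ := fun x => by
    rw [← dist_eq_norm]
    exact (ContinuousMap.dist_apply_le_dist x).trans hpG.le
  have h1 : ‖∫ x, p x ∂μ‖ ≤ δ := by
    refine le_of_tendsto (hmean p hp).norm ?_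
    filter_upwards [eventually_gt_atTop 0] with T hT
    have : ‖∫ t in T₀..(T₀ + T), p (φ t)‖ ≤ δ * |T₀ + T - T₀| := by
      refine intervalIntegral.norm_integral_le_of_norm_le_const fun t ht => ?_
      rw [Set.uIoc_of_le (by linarith)] at ht
      have h0 : g (φ t) = 0 := hg0 (subset_closure ⟨t, ht.1.le, rfl⟩)
      simpa [G, h0] using hpG' (φ t)
    rw [add_sub_cancel_left, abs_of_pos hT] at this
    rw [norm_mul, norm_inv, Complex.norm_real, Real.norm_of_nonneg hT.le, inv_mul_le_iff₀ hT]
    linarith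
  have h2 : ‖∫ x, (G x - p x) ∂μ‖ ≤ δ := by
    simpa using norm_integral_le_of_norm_le_const (μ := μ) (Eventually.of_forall hpG')
  have h3 : ‖∫ x, G x ∂μ‖ = 3 * δ := by
    have : ∫ x, G x ∂μ = ((∫ x, g x ∂μ : ℝ) : ℂ) := integral_ofReal
    rw [this, Complex.norm_real, Real.norm_of_nonneg hpos.le]
    ring
  rw [integral_sub (hint G) (hint p)] at h2
  have := norm_sub_norm_le (∫ x, G x ∂μ) (∫ x, p x ∂μ)
  have : 0 < δ := by positivity
  linarith
/-- The logarithms of distinct shifts of a positive transcendental number by natural numbers are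
linearly independent over the rationals. -/
theorem eq_zero_of_sum_mul_log_add_eq_zero {α : ℝ} (hα : 0 < α) (htr : Transcendental ℚ α)
    {M : ℕ} (k : Fin M → ℤ) (hk : ∑ i, k i * Real.log ((i : ℕ) + α) = 0) : k = 0 := by
  have hpos : ∀ i : Fin M, 0 < ((i : ℕ) : ℝ) + α := fun i => by positivity
  let P : (Fin M → ℤ) → Polynomial ℚ := fun m =>
    ∏ i : Fin M, (Polynomial.X + Polynomial.C ((i : ℕ) : ℚ)) ^ (m i).toNat
  have hPα : ∀ m, Polynomial.aeval α (P m) = Real.exp (∑ i, (m i).toNat * Real.log ((i : ℕ) + α)) := by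
    intro m
    simp only [P, map_prod, map_pow, map_add, Polynomial.aeval_X, Polynomial.aeval_C,
      Real.exp_sum]
    refine Finset.prod_congr rfl fun i _ => ?_
    rw [Real.exp_nat_mul, Real.exp_log (hpos i)]
    simp [add_comm]
  have hcast : ∀ i, (k i : ℝ) = (k i).toNat - (-k i).toNat := fun i => by
    have := Int.toNat_sub_toNat_neg (k i)
    exact_mod_cast this.symm
  have hPeq : P k = P (-k) := by
    rw [← sub_eq_zero]
    by_contra hne
    refine htr ⟨_, hne, ?_⟩
    rw [map_sub, hPα, hPα, sub_eq_zero]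
    congr 1
    rw [← sub_eq_zero, ← hk, ← Finset.sum_sub_distrib]
    refine Finset.sum_congr rfl fun i _ => ?_
    rw [hcast i, Pi.neg_apply]
    ring
  have hroot : ∀ (m : Fin M → ℤ) (j : Fin M),
      (P m).eval (-((j : ℕ) : ℚ)) = 0 ↔ 0 < m j := by
    intro m j
    simp only [P, Polynomial.eval_prod, Polynomial.eval_pow, Polynomial.eval_add,
      Polynomial.eval_X, Polynomial.eval_C, Finset.prod_eq_zero_iff, Finset.mem_univ, true_and,
      pow_eq_zero_iff']
    constructor
    · rintro ⟨i, hi, hm⟩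
      have : i = j := by
        rw [neg_add_eq_zero] at hi
        exact Fin.ext (by exact_mod_cast hi.symm)
      subst this
      lia
    · intro h
      exact ⟨j, by simp, by lia⟩
  funext j
  have h1 := hroot k j
  have h2 := hroot (-k) j
  rw [hPeq] at h1
  have h3 := h1.symm.trans h2
  simp only [Pi.neg_apply] at h3
  simp only [Pi.zero_apply]
  lia

theorem exists_cpow_neg_mul_I_near {α : ℝ} (hα : 0 < α) (htr : Transcendental ℚ α)
    {η : ℕ → ℂ} (hη : ∀ n, ‖η n‖ = 1) (M : ℕ) {ε : ℝ} (hε : 0 < ε) (T₀ : ℝ) :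
    ∃ t : ℝ, T₀ ≤ t ∧ ∀ n < M, ‖((n : ℂ) + (α : ℂ)) ^ (-(t * Complex.I)) - η n‖ < ε := by
  let l : Fin M → ℝ := fun i => -Real.log ((i : ℕ) + α) / (2 * Real.pi)
  have hl : ∀ k : Fin M → ℤ, ∑ i, k i * l i = 0 → k = 0 := by
    intro k hk
    refine eq_zero_of_sum_mul_log_add_eq_zero hα htr k ?_
    have : ∑ i, k i * Real.log ((i : ℕ) + α) = -(2 * Real.pi) * ∑ i, k i * l i := by
      rw [Finset.mul_sum]
      refine Finset.sum_congr rfl fun i _ => ?_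
      simp only [l]
      field_simp
    rw [this, hk, mul_zero]
  let V : Set (UnitAddTorus (Fin M)) :=
    {x | ∀ i : Fin M, ‖((x i).toCircle : ℂ) - η i‖ < ε}
  have hV : IsOpen V := by
    simp only [V, Set.ofPred_forall]
    refine isOpen_iInter_of_finite fun i => isOpen_lt ?_ continuous_const
    have := AddCircle.continuous_toCircle (T := 1)
    fun_prop
  have hVne : V.Nonempty := by
    have hsurj : ∀ n, ∃ x : UnitAddCircle, (x.toCircle : ℂ) = η n := fun n => by
      obtain ⟨x, hx⟩ := (AddCircle.homeomorphCircle (T := 1) one_ne_zero).surjective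
        ⟨η n, mem_sphere_zero_iff_norm.mpr (hη n)⟩
      rw [AddCircle.homeomorphCircle_apply] at hx
      exact ⟨x, by rw [hx]⟩
    choose x hx using hsurj
    exact ⟨fun i => x i, fun i => by simpa [hx] using hε⟩
  obtain ⟨_, hyV, t, ht, rfl⟩ := (dense_forward_orbit_of_linearIndependent l hl T₀).exists_mem_open
    hV hVne |>.imp fun _ h => h.symm
  refine ⟨t, ht, fun n hn => ?_⟩
  have h := hyV ⟨n, hn⟩
  have hpos : 0 < (n : ℝ) + α := by positivity
  convert h using 3
  rw [AddCircle.toCircle_apply_mk, Circle.coe_exp]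
  have hc : ((n : ℂ) + (α : ℂ)) = (((n : ℝ) + α : ℝ) : ℂ) := by push_cast; rfl
  rw [hc, Complex.cpow_def_of_ne_zero (by exact_mod_cast hpos.ne'), ← Complex.ofReal_log hpos.le]
  congr 1
  simp only [l]
  push_cast
  have : (Real.pi : ℂ) ≠ 0 := by exact_mod_cast Real.pi_ne_zero
  field_simp

/-- A quantitative form of Hurwitz's theorem: a holomorphic function uniformly close on a closed
disc to a function vanishing at the centre and bounded below on the boundary has a zero there. -/
theorem exists_zero_of_near {F G : ℂ → ℂ} {z₀ : ℂ} {r δ : ℝ} (hr : 0 < r) (hδ : 0 < δ)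
    (hF : DifferentiableOn ℂ F (Metric.closedBall z₀ r)) (hG : G z₀ = 0)
    (hGδ : ∀ z ∈ Metric.sphere z₀ r, δ ≤ ‖G z‖)
    (hFG : ∀ z ∈ Metric.closedBall z₀ r, ‖F z - G z‖ < δ / 2) :
    ∃ z ∈ Metric.closedBall z₀ r, F z = 0 := by
  by_contra! hne
  have hcl : closure (Metric.ball z₀ r) = Metric.closedBall z₀ r := closure_ball z₀ hr.ne'
  have hd : DiffContOnCl ℂ (fun z => (F z)⁻¹) (Metric.ball z₀ r) := by
    refine DifferentiableOn.diffContOnCl ?_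
    rw [hcl]
    exact hF.inv hne
  have hz₀ : z₀ ∈ Metric.closedBall z₀ r := Metric.mem_closedBall_self hr.le
  have hbound := Complex.norm_le_of_forall_mem_frontier_norm_le Metric.isBounded_ball hd
    (C := (δ / 2)⁻¹) (fun z hz => ?_) (by rwa [hcl] : z₀ ∈ closure (Metric.ball z₀ r))
  · rw [norm_inv, inv_le_inv₀ (norm_pos_iff.mpr (hne z₀ hz₀)) (by positivity)] at hbound
    have := hFG z₀ hz₀
    rw [hG, sub_zero] at this
    linarith
  · rw [frontier_ball z₀ hr.ne'] at hz
    have h1 := hGδ z hz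
    have h2 := hFG z (Metric.sphere_subset_closedBall hz)
    have h3 := norm_sub_norm_le (G z) (F z)
    rw [norm_sub_rev] at h3
    rw [norm_inv]
    exact inv_anti₀ (by positivity) (by linarith)

theorem norm_div_natCast_add_cpow {α : ℝ} (hα : 0 < α) (c : ℂ) (n : ℕ) (s : ℂ) :
    ‖c / ((n : ℂ) + (α : ℂ)) ^ s‖ = ‖c‖ / ((n : ℝ) + α) ^ s.re := by
  have hpos : 0 < (n : ℝ) + α := by positivity
  rw [norm_div, ← Complex.norm_cpow_eq_rpow_re_of_pos hpos]
  push_cast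
  rfl

theorem inv_rpow_le_add_of_mem_Icc {x σ₁ σ₂ σ : ℝ} (hx : 0 < x) (h₁ : σ₁ ≤ σ) (h₂ : σ ≤ σ₂) :
    (x ^ σ)⁻¹ ≤ (x ^ σ₁)⁻¹ + (x ^ σ₂)⁻¹ := by
  have p₁ : 0 < (x ^ σ₁)⁻¹ := by positivity
  have p₂ : 0 < (x ^ σ₂)⁻¹ := by positivity
  rcases le_total 1 x with h | h
  · have : (x ^ σ)⁻¹ ≤ (x ^ σ₁)⁻¹ :=
      inv_anti₀ (by positivity) (Real.rpow_le_rpow_of_exponent_le h h₁)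
    linarith
  · have : (x ^ σ)⁻¹ ≤ (x ^ σ₂)⁻¹ :=
      inv_anti₀ (by positivity) (Real.rpow_le_rpow_of_exponent_ge hx h h₂)
    linarith

theorem summable_inv_natCast_add_rpow {α : ℝ} (hα : 0 < α) {σ : ℝ} (hσ : 1 < σ) :
    Summable fun n : ℕ => (((n : ℝ) + α) ^ σ)⁻¹ := by
  refine ((Real.summable_one_div_nat_add_rpow α σ).mpr hσ).congr fun n => ?_
  rw [one_div, abs_of_pos (by positivity)]

theorem summable_div_natCast_add_cpow {α : ℝ} (hα : 0 < α) {c : ℕ → ℂ} {C : ℝ}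
    (hc : ∀ n, ‖c n‖ ≤ C) {s : ℂ} (hs : 1 < s.re) :
    Summable fun n : ℕ => c n / ((n : ℂ) + (α : ℂ)) ^ s := by
  refine Summable.of_norm_bounded ((summable_inv_natCast_add_rpow hα hs).mul_left C) fun n => ?_
  rw [norm_div_natCast_add_cpow hα, div_eq_mul_inv]
  gcongr
  exact hc n

theorem differentiableOn_tsum_div_natCast_add_cpow {α : ℝ} (hα : 0 < α) {c : ℕ → ℂ} {C : ℝ}
    (hc : ∀ n, ‖c n‖ ≤ C) :
    DifferentiableOn ℂ (fun s : ℂ => ∑' n : ℕ, c n / ((n : ℂ) + (α : ℂ)) ^ s)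
      {s | 1 < s.re} := by
  intro s₀ hs₀
  have hs₀' : 1 < s₀.re := hs₀
  obtain ⟨σ₁, h1, h1'⟩ := exists_between hs₀'
  let U : Set ℂ := {s | σ₁ < s.re ∧ s.re < s₀.re + 1}
  have hU : IsOpen U := (isOpen_lt continuous_const Complex.continuous_re).inter
    (isOpen_lt Complex.continuous_re continuous_const)
  have hd : DifferentiableOn ℂ (fun s : ℂ => ∑' n : ℕ, c n / ((n : ℂ) + (α : ℂ)) ^ s) U := by
    refine Complex.differentiableOn_tsum_of_summable_norm
      (((summable_inv_natCast_add_rpow hα h1).add (summable_inv_natCast_add_rpow hα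
        (by linarith : 1 < s₀.re + 1))).mul_left C) (fun n => ?_) hU (fun n s hs => ?_)
    · have hne : (n : ℂ) + (α : ℂ) ≠ 0 := by
        have : (n : ℝ) + α ≠ 0 := by positivity
        exact_mod_cast this
      intro s _
      refine DifferentiableAt.differentiableWithinAt ?_
      refine (differentiableAt_const _).div (differentiableAt_id.const_cpow (Or.inl hne)) ?_
      simp [Complex.cpow_eq_zero_iff, hne]
    · rw [norm_div_natCast_add_cpow hα, div_eq_mul_inv]
      have := inv_rpow_le_add_of_mem_Icc (x := (n : ℝ) + α) (by positivity) hs.1.le hs.2.le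
      exact mul_le_mul (hc n) this (by positivity) ((norm_nonneg _).trans (hc n))
  exact (hd.differentiableAt (hU.mem_nhds ⟨h1', by linarith⟩)).differentiableWithinAt

theorem not_summable_norm_div_of_periodic {f : ℕ → ℂ} {q : ℕ} (hq : 1 ≤ q)
    (hper : ∀ n, f (n + q) = f n) {α : ℝ} (hα : 0 < α) {m : ℕ} (hm : f m ≠ 0) :
    ¬ Summable fun n : ℕ => ‖f n‖ / ((n : ℝ) + α) := by
  intro h
  have hq' : (0 : ℝ) < q := by exact_mod_cast hq
  have hinj : Function.Injective fun j : ℕ => m + j * q := fun i j hij => by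
    have : i * q = j * q := by simpa using hij
    exact Nat.eq_of_mul_eq_mul_right hq this
  have hfm : ∀ j, f (m + j * q) = f m := fun j => by
    induction j with
    | zero => simp
    | succ j ih => rw [← ih, ← hper (m + j * q)]; ring_nf
  have h1 := (h.comp_injective hinj).mul_left (q / ‖f m‖)
  have h2 : ¬ Summable fun n : ℕ => 1 / |(n : ℝ) + (m + α) / q| ^ (1 : ℝ) := by
    rw [Real.summable_one_div_nat_add_rpow]
    exact lt_irrefl 1
  refine h2 (h1.congr fun j => ?_)
  have : ‖f m‖ ≠ 0 := norm_ne_zero_iff.mpr hm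
  rw [Real.rpow_one, abs_of_pos (by positivity)]
  simp only [Function.comp_apply, hfm]
  push_cast
  have h3 : (m : ℝ) + j * q + α ≠ 0 := by positivity
  have h4 : (j : ℝ) + (m + α) / q ≠ 0 := by positivity
  field_simp
  ring

/-- Near the abscissa of convergence the tail of a divergent nonnegative series outweighs any fixed
term; far to the right the leading term dominates. -/
theorem exists_tsum_eq_two_mul_leading_term {α : ℝ} (hα : 0 < α) {a : ℕ → ℝ} {C : ℝ}
    (ha : ∀ n, 0 ≤ a n) (haC : ∀ n, a n ≤ C) {m : ℕ} (hm : 0 < a m) (hlt : ∀ n < m, a n = 0)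
    (hdiv : ¬ Summable fun n : ℕ => a n / ((n : ℝ) + α)) :
    (∃ σ : ℝ, 1 < σ ∧ ∑' n : ℕ, a n / ((n : ℝ) + α) ^ σ = 2 * (a m / ((m : ℝ) + α) ^ σ)) ∧
    ∃ σ : ℝ, 1 < σ ∧ ∑' n : ℕ, a n / ((n : ℝ) + α) ^ σ < 2 * (a m / ((m : ℝ) + α) ^ σ) := by
  have hC : ∀ n, ‖(a n : ℂ)‖ ≤ C := fun n => by
    rw [Complex.norm_real, Real.norm_of_nonneg (ha n)]
    exact haC n
  have hpos : ∀ n : ℕ, 0 < (n : ℝ) + α := fun n => by positivity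
  have hsum : ∀ σ : ℝ, 1 < σ → Summable fun n : ℕ => a n / ((n : ℝ) + α) ^ σ := fun σ hσ => by
    refine (summable_div_natCast_add_cpow hα hC (s := σ) hσ).norm.congr fun n => ?_
    rw [norm_div_natCast_add_cpow hα, Complex.norm_real, Real.norm_of_nonneg (ha n),
      Complex.ofReal_re]
  let h : ℝ → ℝ := fun σ => ∑' n : ℕ, a n / ((n : ℝ) + α) ^ σ - 2 * (a m / ((m : ℝ) + α) ^ σ)
  have hcont : ContinuousOn h (Set.Ioi 1) := by
    refine ContinuousOn.sub ?_ ?_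
    · have h1 := (differentiableOn_tsum_div_natCast_add_cpow hα hC).continuousOn
      have h2 : ContinuousOn (fun σ : ℝ => (∑' n : ℕ, (a n : ℂ) / ((n : ℂ) + (α : ℂ)) ^ (σ : ℂ)).re)
          (Set.Ioi 1) :=
        Complex.continuous_re.comp_continuousOn
          (h1.comp Complex.continuous_ofReal.continuousOn fun σ hσ => hσ)
      refine h2.congr fun σ _ => ?_
      rw [← Complex.ofReal_re (∑' n : ℕ, a n / ((n : ℝ) + α) ^ σ), Complex.ofReal_tsum]
      congr 2
      funext n
      rw [Complex.ofReal_div, Complex.ofReal_cpow (hpos n).le]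
      push_cast
      rfl
    · refine Continuous.continuousOn ?_
      refine continuous_const.mul (continuous_const.div ?_ fun σ => by have := hpos m; positivity)
      exact Real.continuous_const_rpow (hpos m).ne'
  have hneg : ∃ σ, 1 < σ ∧ h σ < 0 := by
    have hlim : Tendsto (fun σ : ℝ => ∑' n : ℕ, a n * (((m : ℝ) + α) / ((n : ℝ) + α)) ^ σ) atTop
        (𝓝 (∑' n : ℕ, if n = m then a n else 0)) := by
      refine tendsto_tsum_of_dominated_convergence
        (bound := fun n => a n * (((m : ℝ) + α) / ((n : ℝ) + α)) ^ (2 : ℝ)) ?_ ?_ ?_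
      · refine ((hsum 2 one_lt_two).mul_left (((m : ℝ) + α) ^ (2 : ℝ))).congr fun n => ?_
        rw [Real.div_rpow (hpos m).le (hpos n).le]
        ring
      · intro n
        rcases lt_trichotomy n m with hn | rfl | hn
        · simp [hlt n hn]
        · simp [div_self (hpos n).ne']
        · have : ((m : ℝ) + α) / ((n : ℝ) + α) < 1 := by
            rw [div_lt_one (hpos n)]
            have : (m : ℝ) < n := by exact_mod_cast hn
            linarith
          have hp : 0 < ((m : ℝ) + α) / ((n : ℝ) + α) := div_pos (hpos m) (hpos n)
          simpa [hn.ne'] using (tendsto_rpow_atTop_of_base_lt_one _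
            (by linarith) this).const_mul (a n)
      · filter_upwards [eventually_ge_atTop 2] with σ hσ n
        rcases lt_or_ge n m with hn | hn
        · simp [hlt n hn]
        · have hp : 0 < ((m : ℝ) + α) / ((n : ℝ) + α) := div_pos (hpos m) (hpos n)
          have h1 : ((m : ℝ) + α) / ((n : ℝ) + α) ≤ 1 := by
            rw [div_le_one (hpos n)]
            have : (m : ℝ) ≤ n := by exact_mod_cast hn
            linarith
          have := ha n
          rw [Real.norm_of_nonneg (by positivity)]
          exact mul_le_mul_of_nonneg_left (Real.rpow_le_rpow_of_exponent_ge hp h1 hσ) this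
    rw [tsum_ite_eq] at hlim
    obtain ⟨σ, hσ, hσ1⟩ := ((hlim.eventually_lt_const (by linarith : a m < 2 * a m)).and
      (eventually_gt_atTop 1)).exists
    refine ⟨σ, hσ1, ?_⟩
    have hp : 0 < ((m : ℝ) + α) ^ σ := Real.rpow_pos_of_pos (hpos m) _
    have : ∑' n : ℕ, a n * (((m : ℝ) + α) / ((n : ℝ) + α)) ^ σ =
        ((m : ℝ) + α) ^ σ * ∑' n : ℕ, a n / ((n : ℝ) + α) ^ σ := by
      rw [← tsum_mul_left]
      congr 1
      funext n
      rw [Real.div_rpow (hpos m).le (hpos n).le]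
      ring
    rw [this, ← lt_div_iff₀' hp] at hσ
    simp only [h]
    rw [← mul_div_assoc]
    linarith
  have hge : ∃ σ, 1 < σ ∧ 0 ≤ h σ := by
    obtain ⟨N, hN⟩ : ∃ N : ℕ, 2 * (a m / ((m : ℝ) + α)) <
        ∑ n ∈ Finset.range N, a n / ((n : ℝ) + α) := by
      have := (not_summable_iff_tendsto_nat_atTop_of_nonneg
        (fun n => div_nonneg (ha n) (hpos n).le)).mp hdiv
      exact (this.eventually_gt_atTop _).exists
    have hc : Continuous fun σ : ℝ => ∑ n ∈ Finset.range N, a n / ((n : ℝ) + α) ^ σ -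
        2 * (a m / ((m : ℝ) + α) ^ σ) := by
      have h1 : ∀ n : ℕ, Continuous fun σ : ℝ => a n / ((n : ℝ) + α) ^ σ := fun n =>
        continuous_const.div (Real.continuous_const_rpow (hpos n).ne')
          fun σ => (Real.rpow_pos_of_pos (hpos n) σ).ne'
      exact (continuous_finsetSum _ fun n _ => h1 n).sub (continuous_const.mul (h1 m))
    have hev : ∀ᶠ σ in 𝓝[>] (1 : ℝ), 0 < ∑ n ∈ Finset.range N, a n / ((n : ℝ) + α) ^ σ -
        2 * (a m / ((m : ℝ) + α) ^ σ) := by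
      refine (hc.tendsto 1).mono_left nhdsWithin_le_nhds |>.eventually_const_lt ?_
      simp only [Real.rpow_one]
      linarith
    obtain ⟨σ, hσ, hσ1⟩ := (hev.and self_mem_nhdsWithin).exists
    refine ⟨σ, hσ1, ?_⟩
    have := (hsum σ hσ1).sum_le_tsum (Finset.range N)
      fun n _ => div_nonneg (ha n) (Real.rpow_pos_of_pos (hpos n) σ).le
    simp only [h]
    linarith
  obtain ⟨σ₁, h₁, hσ₁⟩ := hneg
  obtain ⟨σ₂, h₂, hσ₂⟩ := hge
  refine ⟨?_, σ₁, h₁, sub_neg.mp hσ₁⟩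
  obtain ⟨σ, hσ, h0⟩ := isPreconnected_Ioi.intermediate_value h₁ h₂ hcont ⟨hσ₁.le, hσ₂⟩
  exact ⟨σ, hσ, sub_eq_zero.mp h0⟩

/-- `F(s + it, f, α)` is, for arbitrarily large `t`, uniformly close on a disc to the series whose
coefficients are rotated by prescribed unimodular factors. -/
theorem exists_shift_near_twist {f : ℕ → ℂ} {C : ℝ} (hC : ∀ n, ‖f n‖ ≤ C) {α : ℝ} (hα : 0 < α)
    (htr : Transcendental ℚ α) {η : ℕ → ℂ} (hη : ∀ n, ‖η n‖ = 1) {σ₁ σ₂ : ℝ} (hσ₁ : 1 < σ₁)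
    (hσ : σ₁ ≤ σ₂) {ε : ℝ} (hε : 0 < ε) (T₀ : ℝ) :
    ∃ t : ℝ, T₀ ≤ t ∧ ∀ s : ℂ, σ₁ ≤ s.re → s.re ≤ σ₂ →
      ‖∑' n : ℕ, f n / ((n : ℂ) + (α : ℂ)) ^ (s + t * Complex.I) -
        ∑' n : ℕ, f n * η n / ((n : ℂ) + (α : ℂ)) ^ s‖ < ε := by
  have hC0 : 0 ≤ C := (norm_nonneg _).trans (hC 0)
  let u : ℕ → ℝ := fun n => C * ((((n : ℝ) + α) ^ σ₁)⁻¹ + (((n : ℝ) + α) ^ σ₂)⁻¹)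
  have hu : Summable u := ((summable_inv_natCast_add_rpow hα hσ₁).add
    (summable_inv_natCast_add_rpow hα (hσ₁.trans_le hσ))).mul_left C
  have hu0 : ∀ n, 0 ≤ u n := fun n => by positivity
  obtain ⟨M, hM⟩ := ((tendsto_sum_nat_add u).eventually_lt_const
    (by positivity : (0 : ℝ) < ε / 4)).exists
  set S := ∑ n ∈ Finset.range M, u n with hS
  have hS0 : 0 ≤ S := Finset.sum_nonneg fun n _ => hu0 n
  obtain ⟨t, ht, hnear⟩ := exists_cpow_neg_mul_I_near hα htr hη M
    (by positivity : 0 < ε / (2 * (S + 1))) T₀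
  refine ⟨t, ht, fun s hs₁ hs₂ => ?_⟩
  have hs : 1 < s.re := hσ₁.trans_le hs₁
  let e : ℕ → ℂ := fun n => ((n : ℂ) + (α : ℂ)) ^ (-(t * Complex.I))
  have hne : ∀ n : ℕ, (n : ℂ) + (α : ℂ) ≠ 0 := fun n => by
    have : (n : ℝ) + α ≠ 0 := by positivity
    exact_mod_cast this
  have hsplit : ∀ n : ℕ, f n / ((n : ℂ) + (α : ℂ)) ^ (s + t * Complex.I) -
      f n * η n / ((n : ℂ) + (α : ℂ)) ^ s =
        (e n - η n) * (f n / ((n : ℂ) + (α : ℂ)) ^ s) := fun n => by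
    simp only [e]
    rw [Complex.cpow_add _ _ (hne n), Complex.cpow_neg]
    have h1 : ((n : ℂ) + (α : ℂ)) ^ s ≠ 0 := by simp [Complex.cpow_eq_zero_iff, hne]
    have h2 : ((n : ℂ) + (α : ℂ)) ^ (t * Complex.I) ≠ 0 := by
      simp [Complex.cpow_eq_zero_iff, hne]
    field_simp
  have hfu : ∀ n : ℕ, ‖f n / ((n : ℂ) + (α : ℂ)) ^ s‖ ≤ u n := fun n => by
    rw [norm_div_natCast_add_cpow hα, div_eq_mul_inv]
    have := inv_rpow_le_add_of_mem_Icc (x := (n : ℝ) + α) (by positivity) hs₁ hs₂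
    exact mul_le_mul (hC n) this (by positivity) hC0
  have hen : ∀ n, ‖e n‖ = 1 := fun n => by
    have hp : 0 < (n : ℝ) + α := by positivity
    have := Complex.norm_cpow_eq_rpow_re_of_pos hp (-(t * Complex.I))
    push_cast at this
    simp [e, this]
  have hbd : ∀ n, ‖(e n - η n) * (f n / ((n : ℂ) + (α : ℂ)) ^ s)‖ ≤ 2 * u n := fun n => by
    rw [norm_mul]
    refine mul_le_mul ?_ (hfu n) (norm_nonneg _) zero_le_two
    refine (norm_sub_le _ _).trans ?_
    rw [hen, hη]
    norm_num
  have hsm := (hu.mul_left 2).of_norm_bounded hbd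
  have hηC : ∀ n, ‖f n * η n‖ ≤ C := fun n => by simpa [hη] using hC n
  have hs' : 1 < (s + t * Complex.I).re := by simpa using hs
  rw [← (summable_div_natCast_add_cpow hα hC hs').tsum_sub
    (summable_div_natCast_add_cpow hα hηC hs), tsum_congr hsplit, ← hsm.sum_add_tsum_nat_add M]
  refine (norm_add_le _ _).trans_lt ?_
  have h1 : ‖∑ n ∈ Finset.range M, (e n - η n) * (f n / ((n : ℂ) + (α : ℂ)) ^ s)‖ ≤
      ε / (2 * (S + 1)) * S := by
    rw [hS, Finset.mul_sum, ← hS]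
    refine norm_sum_le_of_le _ fun n hn => ?_
    rw [norm_mul]
    exact mul_le_mul (hnear n (Finset.mem_range.mp hn)).le (hfu n) (norm_nonneg _) (by positivity)
  have h2 := tsum_of_norm_bounded
    (((summable_nat_add_iff M).mpr hu).mul_left 2).hasSum (fun n => hbd (n + M))
  rw [tsum_mul_left] at h2
  have h3 : ε / (2 * (S + 1)) * S ≤ ε / 2 := by
    rw [div_mul_eq_mul_div, div_le_div_iff₀ (by positivity) (by positivity)]
    nlinarith
  linarith

/-- For `f` periodic of period `q ≥ 1`, not identically zero, and `α`
transcendental with `0 < α < 1`, the series `F(s, f, α) = ∑ f(n)/(n+α)^s` has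
infinitely many zeros with `Re s > 1`. -/
theorem generalized_hurwitz_zeros_transcendental
    (f : ℕ → ℂ) (hf : f ≠ 0) (q : ℕ) (hq : 1 ≤ q) (hper : ∀ n, f (n + q) = f n)
    (α : ℝ) (hα0 : 0 < α) (hα1 : α < 1) (htr : Transcendental ℚ α) :
    {s : ℂ | 1 < s.re ∧ ∑' n : ℕ, f n / ((n : ℂ) + (α : ℂ)) ^ s = 0}.Infinite := by
  classical
  obtain ⟨C, hC⟩ : ∃ C : ℝ, ∀ n, ‖f n‖ ≤ C := by
    refine ⟨∑ n ∈ Finset.range q, ‖f n‖, fun n => ?_⟩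
    rw [← Function.Periodic.map_mod_nat hper n]
    exact Finset.single_le_sum (f := fun n => ‖f n‖) (fun _ _ => norm_nonneg _)
      (Finset.mem_range.mpr (Nat.mod_lt n hq))
  have hex : ∃ n, f n ≠ 0 := Function.ne_iff.mp hf
  let m := Nat.find hex
  have hm : f m ≠ 0 := Nat.find_spec hex
  have hlt : ∀ n < m, ‖f n‖ = 0 := fun n hn => by
    rw [norm_eq_zero]
    exact not_not.mp (Nat.find_min hex hn)
  obtain ⟨⟨σ₀, hσ₀, hzero⟩, σ₁, hσ₁, hlt₁⟩ := exists_tsum_eq_two_mul_leading_term hα0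
    (fun n => norm_nonneg (f n)) hC (norm_pos_iff.mpr hm) hlt
    (not_summable_norm_div_of_periodic hq hper hα0 hm)
  let c : ℕ → ℂ := fun n => if n = m then -(‖f n‖ : ℂ) else ‖f n‖
  let η : ℕ → ℂ := fun n => if f n = 0 then 1 else c n / f n
  have hcn : ∀ n, ‖c n‖ = ‖f n‖ := fun n => by
    by_cases h : n = m <;> simp [c, h]
  have hη : ∀ n, ‖η n‖ = 1 := fun n => by
    by_cases h : f n = 0
    · simp [η, h]
    · simp [η, h, hcn]
  have hcη : ∀ n, f n * η n = c n := fun n => by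
    by_cases h : f n = 0
    · simp [c, h]
    · simp only [η, h, if_false]
      field_simp
  have hcC : ∀ n, ‖c n‖ ≤ C := fun n => (hcn n).le.trans (hC n)
  let G : ℂ → ℂ := fun s => ∑' n : ℕ, c n / ((n : ℂ) + (α : ℂ)) ^ s
  have hGdiff : DifferentiableOn ℂ G {s | 1 < s.re} :=
    differentiableOn_tsum_div_natCast_add_cpow hα0 hcC
  have hopen : IsOpen {s : ℂ | 1 < s.re} := isOpen_lt continuous_const Complex.continuous_re
  have hGreal : ∀ σ : ℝ, 1 < σ → G σ = ((∑' n : ℕ, ‖f n‖ / ((n : ℝ) + α) ^ σ -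
      2 * (‖f m‖ / ((m : ℝ) + α) ^ σ) : ℝ) : ℂ) := fun σ hσ => by
    have hs := (summable_div_natCast_add_cpow hα0 hC (s := σ) hσ).norm
    simp only [norm_div_natCast_add_cpow hα0, Complex.ofReal_re] at hs
    have hi : Summable fun n : ℕ => if n = m then 2 * (‖f n‖ / ((n : ℝ) + α) ^ σ) else 0 :=
      summable_of_ne_finset_zero (s := {m}) fun n hn => if_neg (by simpa using hn)
    rw [← tsum_ite_eq m fun n => 2 * (‖f n‖ / ((n : ℝ) + α) ^ σ), ← hs.tsum_sub hi,
      Complex.ofReal_tsum]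
    refine tsum_congr fun n => ?_
    have hp : 0 ≤ (n : ℝ) + α := by positivity
    have : (((n : ℝ) + α : ℝ) : ℂ) ^ (σ : ℂ) = ((n : ℂ) + (α : ℂ)) ^ (σ : ℂ) := by
      push_cast
      rfl
    by_cases h : n = m
    · simp only [c, h, if_true] at this ⊢
      rw [← this, ← Complex.ofReal_cpow (h ▸ hp)]
      push_cast
      ring
    · simp only [c, h, if_false]
      rw [← this, ← Complex.ofReal_cpow hp]
      push_cast
      ring
  have hG₀ : G σ₀ = 0 := by
    rw [hGreal σ₀ hσ₀, hzero, sub_self, Complex.ofReal_zero]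
  have hG₁ : G σ₁ ≠ 0 := by
    rw [hGreal σ₁ hσ₁]
    exact_mod_cast (sub_neg.mpr hlt₁).ne
  have hGan : AnalyticOnNhd ℂ G {s | 1 < s.re} := hGdiff.analyticOnNhd hopen
  have hiso : ∀ᶠ z in 𝓝[≠] (σ₀ : ℂ), G z ≠ 0 := by
    by_contra h
    have hfreq : ∃ᶠ z in 𝓝[≠] (σ₀ : ℂ), G z = 0 := h
    have hpre : IsPreconnected {s : ℂ | 1 < s.re} := (convex_halfSpace_re_gt 1).isPreconnected
    have hEq : Set.EqOn G 0 {s : ℂ | 1 < s.re} :=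
      hGan.eqOn_zero_of_preconnected_of_frequently_eq_zero hpre
        (show (σ₀ : ℂ) ∈ {s : ℂ | 1 < s.re} from hσ₀) hfreq
    exact hG₁ (hEq (show (σ₁ : ℂ) ∈ {s : ℂ | 1 < s.re} from hσ₁))
  obtain ⟨ρ, hρ, hGρ⟩ := Metric.eventually_nhds_iff.mp (eventually_nhdsWithin_iff.mp hiso)
  obtain ⟨r, hr, hrmin⟩ := exists_between (lt_min hρ (sub_pos.mpr hσ₀))
  have hrρ := hrmin.trans_le (min_le_left _ _)
  have hrσ := hrmin.trans_le (min_le_right _ _)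
  have hre : ∀ z ∈ Metric.closedBall (σ₀ : ℂ) r, σ₀ - r ≤ z.re ∧ z.re ≤ σ₀ + r := fun z hz => by
    have h1 := (Complex.abs_re_le_norm (z - σ₀)).trans (mem_closedBall_iff_norm.mp hz)
    rw [Complex.sub_re, Complex.ofReal_re, abs_le] at h1
    constructor <;> linarith
  obtain ⟨z₁, hz₁, hmin⟩ := (isCompact_sphere (σ₀ : ℂ) r).exists_isMinOn
    (NormedSpace.sphere_nonempty.mpr hr.le) (f := fun z => ‖G z‖)
    ((hGdiff.continuousOn.mono fun z hz => by
      have := (hre z (Metric.sphere_subset_closedBall hz)).1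
      show 1 < z.re
      linarith).norm)
  have hδ : 0 < ‖G z₁‖ := by
    rw [norm_pos_iff]
    rw [mem_sphere_iff_norm] at hz₁
    refine hGρ (by rw [dist_eq_norm]; linarith) fun h => ?_
    rw [Set.mem_singleton_iff.mp h, sub_self, norm_zero] at hz₁
    exact hr.ne hz₁
  intro hfin
  obtain ⟨B, hB⟩ := (hfin.image Complex.im).bddAbove
  obtain ⟨t, ht, hnear⟩ := exists_shift_near_twist hC hα0 htr hη (σ₁ := σ₀ - r) (σ₂ := σ₀ + r)
    (by linarith) (by linarith) (half_pos hδ) (B + r + 1)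
  simp only [hcη] at hnear
  have hF : DifferentiableOn ℂ
      (fun s : ℂ => ∑' n : ℕ, f n / ((n : ℂ) + (α : ℂ)) ^ (s + t * Complex.I))
      (Metric.closedBall (σ₀ : ℂ) r) := by
    have hadd : DifferentiableOn ℂ (fun s : ℂ => s + t * Complex.I)
        (Metric.closedBall (σ₀ : ℂ) r) := by fun_prop
    refine (differentiableOn_tsum_div_natCast_add_cpow hα0 hC).comp hadd fun z hz => ?_
    have h1 := (hre z hz).1
    have h2 : (z + t * Complex.I).re = z.re := by simp
    show 1 < (z + t * Complex.I).re
    linarith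
  obtain ⟨z, hz, hFz⟩ := exists_zero_of_near hr hδ hF
    hG₀ (fun z hz => hmin hz) (fun z hz => hnear z (hre z hz).1 (hre z hz).2)
  have hzim := hB ⟨z + t * Complex.I, ⟨by
    have := (hre z hz).1
    simp
    linarith, hFz⟩, rfl⟩
  have h1 := (Complex.abs_im_le_norm (z - σ₀)).trans (mem_closedBall_iff_norm.mp hz)
  rw [Complex.sub_im, Complex.ofReal_im, abs_le] at h1
  simp at hzim
  linarith
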